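/- Let A be an algebra with Day operations m₀,…,m_n, let k ≥ 2, T = (θ₀,…,θ_{k-1}) ∈ Con(A)^k, and h ∈ M(T). Then for every nonempty sequence d = (d₀,…,dᵢ) with entries in {0,…,n} and i+1 ≤ k-1, the matrix h^d lies in M(T), and for every g : {0,…,k-1}∖{i+1} → {0,1} with g(j) = 0 for some j ≤ i, the (i+1)-cross-section line of h^d at g is a constant pair ⟨s,s⟩. -/

import Mathlib

namespace UACommutator

/-- A signature: a type of operation symbols with arities. -/
structure Signature where
  ops : Type
  arity : ops → ℕ

/-- An algebra for a signature: a nonempty carrier with interpretations of the operations. -/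
structure Alg (σ : Signature) where
  carrier : Type
  nonempty : Nonempty carrier
  interp : (o : σ.ops) → (Fin (σ.arity o) → carrier) → carrier

/-- A congruence of an algebra: an equivalence relation compatible with all basic operations. -/
structure Congruence {σ : Signature} (A : Alg σ) where
  rel : A.carrier → A.carrier → Prop
  iseqv : Equivalence rel
  compat : ∀ (o : σ.ops) (x y : Fin (σ.arity o) → A.carrier),
    (∀ i, rel (x i) (y i)) → rel (A.interp o x) (A.interp o y)

instance {σ : Signature} {A : Alg σ} : LE (Congruence A) :=
  ⟨fun a b => ∀ x y, a.rel x y → b.rel x y⟩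

/-- Terms of the signature with variables in `V`. -/
inductive Term (σ : Signature) (V : Type) : Type
  | var : V → Term σ V
  | app : (o : σ.ops) → (Fin (σ.arity o) → Term σ V) → Term σ V

def Term.evalA {σ : Signature} (A : Alg σ) {V : Type} :
    Term σ V → (V → A.carrier) → A.carrier
  | .var v, env => env v
  | .app o args, env => A.interp o (fun i => (args i).evalA A env)

/-- Polynomial operations of an algebra `A` with variables in `V`:
built from variables, constants of `A`, and the basic operations. -/
inductive Poly {σ : Signature} (A : Alg σ) (V : Type) : Type
  | var : V → Poly A V
  | const : A.carrier → Poly A V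
  | app : (o : σ.ops) → (Fin (σ.arity o) → Poly A V) → Poly A V

def Poly.eval {σ : Signature} {A : Alg σ} {V : Type} :
    Poly A V → (V → A.carrier) → A.carrier
  | .var v, env => env v
  | .const c, _ => c
  | .app o args, env => A.interp o (fun i => (args i).eval env)

/-- Evaluate a polynomial whose variables are grouped into `k` tuples (tuple `i` of
length `ν i`) at the tuples `a i` (where `g i = false`) or `b i` (where `g i = true`). -/
def evalTup {σ : Signature} {A : Alg σ} {k : ℕ} {ν : Fin k → ℕ}
    (p : Poly A (Σ i, Fin (ν i))) (a b : ∀ i, Fin (ν i) → A.carrier)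
    (g : Fin k → Bool) : A.carrier :=
  p.eval (fun x => if g x.1 then b x.1 x.2 else a x.1 x.2)

/-- The term condition `C(α₀,…,α_{k-1}; δ)`, centralizing at coordinate `j`. -/
def TC {σ : Signature} {A : Alg σ} {k : ℕ} (α : Fin k → Congruence A) (j : Fin k)
    (δ : Congruence A) : Prop :=
  ∀ (ν : Fin k → ℕ) (p : Poly A (Σ i, Fin (ν i)))
    (a b : ∀ i, Fin (ν i) → A.carrier),
    (∀ i mm, (α i).rel (a i mm) (b i mm)) →
    (∀ g : Fin k → Bool, g j = false → (∃ i, i ≠ j ∧ g i = false) →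
      δ.rel (evalTup p a b g) (evalTup p a b (Function.update g j true))) →
    δ.rel (evalTup p a b (Function.update (fun _ => true) j false))
          (evalTup p a b (fun _ => true))

/-- The meet (intersection) of a family of congruences. -/
def infCong {σ : Signature} {A : Alg σ} {ι : Sort*} (ds : ι → Congruence A) :
    Congruence A where
  rel x y := ∀ i, (ds i).rel x y
  iseqv := ⟨fun x i => (ds i).iseqv.refl x,
            fun h i => (ds i).iseqv.symm (h i),
            fun h h' i => (ds i).iseqv.trans (h i) (h' i)⟩
  compat o x y h := fun i => (ds i).compat o x y (fun mm => h mm i)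

/-- The higher commutator `[α₀,…,α_{k-1}]` (term-condition version), as the meet of
all congruences `δ` such that `C(α₀,…,α_{k-1}; δ)` holds, centralizing at `j`. -/
def commTC {σ : Signature} {A : Alg σ} {k : ℕ} (α : Fin k → Congruence A) (j : Fin k) :
    Congruence A :=
  infCong (fun d : {δ : Congruence A // TC α j δ} => d.val)

/-- The congruence generated by a binary relation `X`. -/
def Cg {σ : Signature} {A : Alg σ} (X : A.carrier → A.carrier → Prop) : Congruence A :=
  infCong (fun d : {δ : Congruence A // ∀ x y, X x y → δ.rel x y} => d.val)

theorem Cg_base {σ : Signature} {A : Alg σ} (X : A.carrier → A.carrier → Prop)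
    {x y : A.carrier} (h : X x y) : (Cg X).rel x y :=
  fun i => i.2 x y h

/-- The join of a family of congruences: the least congruence containing every member. -/
def supCong {σ : Signature} {A : Alg σ} {ι : Sort*} (γ : ι → Congruence A) :
    Congruence A :=
  Cg (fun x y => ∃ i, (γ i).rel x y)

/-- The join of two congruences. -/
def joinCong {σ : Signature} {A : Alg σ} (a b : Congruence A) : Congruence A :=
  Cg (fun x y => a.rel x y ∨ b.rel x y)

/-- `m` is a `T`-matrix for `T = (θ₀,…,θ_{k-1})`. -/
def IsMatrix {σ : Signature} {A : Alg σ} {k : ℕ} (θ : Fin k → Congruence A)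
    (m : (Fin k → Bool) → A.carrier) : Prop :=
  ∃ (ν : Fin k → ℕ) (p : Poly A (Σ i, Fin (ν i))) (a b : ∀ i, Fin (ν i) → A.carrier),
    (∀ i jj, (θ i).rel (a i jj) (b i jj)) ∧
    ∀ f : Fin k → Bool, m f = evalTup p a b f

/-- The matrix centralization condition `C(T; j; δ)`: for every `T`-matrix, if every
`(j)`-supporting line is a `δ`-pair then the `(j)`-pivot line is a `δ`-pair. -/
def CMat {σ : Signature} {A : Alg σ} {k : ℕ} (θ : Fin k → Congruence A) (j : Fin k)
    (δ : Congruence A) : Prop :=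
  ∀ m : (Fin k → Bool) → A.carrier, IsMatrix θ m →
    (∀ g : Fin k → Bool, (∃ i, i ≠ j ∧ g i = false) →
      δ.rel (m (Function.update g j false)) (m (Function.update g j true))) →
    δ.rel (m (Function.update (fun _ => true) j false)) (m (fun _ => true))

/-- `[T]_j`: the meet of all congruences `δ` with `C(T; j; δ)`. -/
def commMat {σ : Signature} {A : Alg σ} {k : ℕ} (θ : Fin k → Congruence A) (j : Fin k) :
    Congruence A :=
  infCong (fun d : {δ : Congruence A // CMat θ j δ} => d.val)

/-- Day operations `m₀, …, m_n` for an algebra, each induced by a term of the signature. -/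
structure DayOps {σ : Signature} (A : Alg σ) (n : ℕ) where
  m : Fin (n+1) → A.carrier → A.carrier → A.carrier → A.carrier → A.carrier
  isTerm : ∀ e, ∃ t : Term σ (Fin 4), ∀ x y z u, m e x y z u = t.evalA A ![x, y, z, u]
  idem : ∀ e x y, m e x y y x = x
  first : ∀ x y z u, m 0 x y z u = x
  last : ∀ x y z u, m (Fin.last n) x y z u = u
  even : ∀ (e : ℕ) (he : e < n), Even e → ∀ x u,
    m ⟨e, by omega⟩ x x u u = m ⟨e+1, by omega⟩ x x u u
  odd : ∀ (e : ℕ) (he : e < n), Odd e → ∀ x y u,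
    m ⟨e, by omega⟩ x y y u = m ⟨e+1, by omega⟩ x y y u

/-- The `e`-th shift rotation at `(j, l)` of a cube `h`. -/
def shiftRot {σ : Signature} {A : Alg σ} {n k : ℕ} (D : DayOps A n) (e : Fin (n+1))
    (j l : Fin k) (h : (Fin k → Bool) → A.carrier) :
    (Fin k → Bool) → A.carrier := fun f =>
  let r := h (Function.update (Function.update f j false) l false)
  let s := h (Function.update (Function.update f j false) l true)
  let u := h (Function.update (Function.update f j true) l false)
  let v := h (Function.update (Function.update f j true) l true)
  if f j then (if f l then D.m e s s v v else D.m e s r u v) else s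

/-- `hIter D m hm d h` is `h^{(d₀,…,d_{m-1})}`: the result of applying the shift
rotations `R^{d₀}_{0,1}, …, R^{d_{m-1}}_{m-1,m}` successively to `h`. -/
def hIter {σ : Signature} {A : Alg σ} {n k : ℕ} (D : DayOps A n) :
    (m : ℕ) → m < k → (Fin m → Fin (n+1)) → ((Fin k → Bool) → A.carrier) →
    ((Fin k → Bool) → A.carrier)
  | 0, _, _, h => h
  | (m+1), hm, d, h =>
      shiftRot D (d (Fin.last m)) ⟨m, by omega⟩ ⟨m+1, hm⟩
        (hIter D m (by omega) (fun i => d i.castSucc) h)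

/-- `X(T)`: the set of `(k-1)`-pivot lines of the matrices `h^d`, over all `T`-matrices
`h` and all `d ∈ {0,…,n}^{k-1}`. -/
def XSet {σ : Signature} {A : Alg σ} {n k : ℕ} (hk : 0 < k) (D : DayOps A n)
    (θ : Fin k → Congruence A) : A.carrier → A.carrier → Prop :=
  fun x y => ∃ h : (Fin k → Bool) → A.carrier, IsMatrix θ h ∧
    ∃ d : Fin (k-1) → Fin (n+1),
      x = hIter D (k-1) (by omega) d h
            (Function.update (fun _ => true) (⟨k-1, by omega⟩ : Fin k) false) ∧
      y = hIter D (k-1) (by omega) d h (fun _ => true)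

/-- Product algebra `A^I` with pointwise operations. -/
def prodAlg {σ : Signature} (A : Alg σ) (I : Type) : Alg σ where
  carrier := I → A.carrier
  nonempty := ⟨fun _ => Classical.choice A.nonempty⟩
  interp o x := fun i => A.interp o (fun mm => x mm i)

/-- Membership in the subalgebra of `B` generated by a set `S`. -/
inductive Gen {σ : Signature} (B : Alg σ) (S : Set B.carrier) : B.carrier → Prop
  | base : ∀ x ∈ S, Gen B S x
  | app : ∀ (o : σ.ops) (x : Fin (σ.arity o) → B.carrier),
      (∀ i, Gen B S (x i)) → Gen B S (B.interp o x)

/-- `f : A → B` is a homomorphism. -/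
def IsHom {σ : Signature} (A B : Alg σ) (f : A.carrier → B.carrier) : Prop :=
  ∀ (o : σ.ops) (x : Fin (σ.arity o) → A.carrier),
    f (A.interp o x) = B.interp o (fun i => f (x i))

/-- The kernel congruence of a homomorphism. -/
def kerCong {σ : Signature} {A B : Alg σ} (f : A.carrier → B.carrier)
    (hf : IsHom A B f) : Congruence A where
  rel x y := f x = f y
  iseqv := ⟨fun _ => rfl, Eq.symm, Eq.trans⟩
  compat o x y h := by
    show f (A.interp o x) = f (A.interp o y)
    rw [hf o x, hf o y]
    congr 1
    funext i
    exact h i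

/-- The image `f(γ)` of a congruence `γ ≥ ker f` under a surjective homomorphism `f`. -/
def mapCong {σ : Signature} {A B : Alg σ} (f : A.carrier → B.carrier)
    (hf : IsHom A B f) (hs : Function.Surjective f) (γ : Congruence A)
    (hγ : ∀ x y, f x = f y → γ.rel x y) : Congruence B where
  rel u v := ∃ x y, γ.rel x y ∧ f x = u ∧ f y = v
  iseqv := by
    refine ⟨?_, ?_, ?_⟩
    · intro u
      obtain ⟨x, hx⟩ := hs u
      exact ⟨x, x, γ.iseqv.refl x, hx, hx⟩
    · rintro u v ⟨x, y, hxy, hx, hy⟩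
      exact ⟨y, x, γ.iseqv.symm hxy, hy, hx⟩
    · rintro u v w ⟨x, y, hxy, hx, hy⟩ ⟨y', z, hyz, hy', hz⟩
      exact ⟨x, z, γ.iseqv.trans hxy (γ.iseqv.trans (hγ y y' (hy.trans hy'.symm)) hyz),
        hx, hz⟩
  compat o u v h := by
    choose x y hxy hx hy using h
    refine ⟨A.interp o x, A.interp o y, γ.compat o x y hxy, ?_, ?_⟩
    · rw [hf o x]
      congr 1
      funext i
      exact hx i
    · rw [hf o y]
      congr 1
      funext i
      exact hy i

/-- The preimage `f⁻¹(β)` of a congruence of `B` under a homomorphism `f`. -/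
def comapCong {σ : Signature} {A B : Alg σ} (f : A.carrier → B.carrier)
    (hf : IsHom A B f) (β : Congruence B) : Congruence A where
  rel x y := β.rel (f x) (f y)
  iseqv := ⟨fun _ => β.iseqv.refl _, β.iseqv.symm, β.iseqv.trans⟩
  compat o x y h := by
    show β.rel (f (A.interp o x)) (f (A.interp o y))
    rw [hf o x, hf o y]
    exact β.compat o _ _ h

/-- Renaming the variables of a polynomial. -/
def Poly.rename {σ : Signature} {A : Alg σ} {V W : Type} (φ : V → W) : Poly A V → Poly A W
  | .var v => .var (φ v)
  | .const c => .const c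
  | .app o args => .app o (fun i => (args i).rename φ)

theorem Poly.eval_rename {σ : Signature} {A : Alg σ} {V W : Type} (φ : V → W)
    (p : Poly A V) (env : W → A.carrier) :
    (p.rename φ).eval env = p.eval (fun v => env (φ v)) := by
  induction p with
  | var v => rfl
  | const c => rfl
  | app o args ih => simp only [Poly.rename, Poly.eval, ih]

/-- Substituting polynomials for the variables of a term. -/
def Term.substPoly {σ : Signature} {A : Alg σ} {V W : Type} (q : V → Poly A W) :
    Term σ V → Poly A W
  | .var v => q v
  | .app o args => .app o (fun i => (args i).substPoly q)

theorem Term.eval_substPoly {σ : Signature} {A : Alg σ} {V W : Type} (q : V → Poly A W)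
    (t : Term σ V) (env : W → A.carrier) :
    (t.substPoly q).eval env = t.evalA A (fun v => (q v).eval env) := by
  induction t with
  | var v => rfl
  | app o args ih => simp only [Term.substPoly, Poly.eval, Term.evalA, ih]

/-- The variables of a polynomial defining a `T`-matrix may be grouped into arbitrary finite
types. -/
theorem IsMatrix.of_fintype {σ : Signature} {A : Alg σ} {k : ℕ} {θ : Fin k → Congruence A}
    {m : (Fin k → Bool) → A.carrier} (V : Fin k → Type) [∀ i, Fintype (V i)]
    (p : Poly A (Σ i, V i)) (a b : ∀ i, V i → A.carrier)
    (hab : ∀ i v, (θ i).rel (a i v) (b i v))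
    (hm : ∀ f, m f = p.eval (fun x => if f x.1 then b x.1 x.2 else a x.1 x.2)) :
    IsMatrix θ m := by
  let ε := fun i => Fintype.equivFin (V i)
  refine ⟨fun i => Fintype.card (V i), p.rename (fun x => ⟨x.1, ε x.1 x.2⟩),
    fun i v => a i ((ε i).symm v), fun i v => b i ((ε i).symm v), fun i v => hab i _, ?_⟩
  intro f
  simp only [hm, evalTup, Poly.eval_rename, Equiv.symm_apply_apply]

/-- `T`-matrices are closed under term operations of finite arity. -/
theorem IsMatrix.term {σ : Signature} {A : Alg σ} {k : ℕ} {θ : Fin k → Congruence A}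
    {C : Type} [Fintype C] (t : Term σ C) (M : C → (Fin k → Bool) → A.carrier)
    (hM : ∀ c, IsMatrix θ (M c)) :
    IsMatrix θ (fun f => t.evalA A (fun c => M c f)) := by
  choose ν p a b hab hMp using hM
  refine IsMatrix.of_fintype (fun i => Σ c, Fin (ν c i))
    (t.substPoly (fun c => (p c).rename (fun x => ⟨x.1, c, x.2⟩)))
    (fun i v => a v.1 i v.2) (fun i v => b v.1 i v.2) (fun i v => hab v.1 i v.2) ?_
  intro f
  simp only [Term.eval_substPoly, Poly.eval_rename, hMp, evalTup]

/-- Collapsing a coordinate of a `T`-matrix to one of its two faces gives a `T`-matrix. -/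
theorem IsMatrix.update {σ : Signature} {A : Alg σ} {k : ℕ} {θ : Fin k → Congruence A}
    {h : (Fin k → Bool) → A.carrier} (hh : IsMatrix θ h) (j : Fin k) (c : Bool) :
    IsMatrix θ (fun f => h (Function.update f j c)) := by
  obtain ⟨ν, p, a, b, hab, hp⟩ := hh
  refine ⟨ν, p, fun i v => if i = j then (if c then b i v else a i v) else a i v,
    fun i v => if i = j then (if c then b i v else a i v) else b i v, ?_, ?_⟩
  · intro i v
    dsimp only
    split_ifs
    · exact (θ i).iseqv.refl _
    · exact (θ i).iseqv.refl _
    · exact hab i v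
  · intro f
    simp only [hp]
    unfold evalTup
    congr 1
    funext x
    by_cases hx : x.1 = j
    · simp [hx]
    · simp [hx, Function.update_of_ne]

/-- Shift rotations of `T`-matrices are `T`-matrices. -/
theorem IsMatrix.shiftRot {σ : Signature} {A : Alg σ} {n k : ℕ} {θ : Fin k → Congruence A}
    {h : (Fin k → Bool) → A.carrier} (hh : IsMatrix θ h) (D : DayOps A n) (e : Fin (n + 1))
    {j l : Fin k} (hjl : j ≠ l) : IsMatrix θ (shiftRot D e j l h) := by
  obtain ⟨t, ht⟩ := D.isTerm e
  have key := IsMatrix.term t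
    ![fun f => h (Function.update (Function.update f j false) l true),
      fun f => h (Function.update f j false), h, fun f => h (Function.update f l true)]
    (θ := θ) (by
      intro c
      fin_cases c
      · exact (hh.update l true).update j false
      · exact hh.update j false
      · exact hh
      · exact hh.update l true)
  convert key using 1
  funext f
  have hv : (fun c => (![fun f => h (Function.update (Function.update f j false) l true),
      fun f => h (Function.update f j false), h, fun f => h (Function.update f l true)]
        : Fin 4 → (Fin k → Bool) → A.carrier) c f) =
      ![h (Function.update (Function.update f j false) l true),
        h (Function.update f j false), h f, h (Function.update f l true)] := by
    funext c
    fin_cases c <;> rfl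
  rw [hv, ← ht]
  have hl : ∀ c, f l = c → Function.update f l c = f := by
    rintro _ rfl
    exact Function.update_eq_self l f
  have hj : ∀ c, f j = c → Function.update f j c = f := by
    rintro _ rfl
    exact Function.update_eq_self j f
  have hlj : ∀ c c', f l = c' →
      Function.update (Function.update f j c) l c' = Function.update f j c := by
    rintro c _ rfl
    rw [Function.update_comm hjl, Function.update_eq_self]
  unfold UACommutator.shiftRot
  cases hfj : f j <;> cases hfl : f l <;>
    simp [hj _ hfj, hl _ hfl, hlj _ _ hfl, D.idem]

/-- If `g j = false`, the line of a shift rotation in direction `l` at `g` is constant. -/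
theorem shiftRot_line_of_eq_false {σ : Signature} {A : Alg σ} {n k : ℕ} (D : DayOps A n)
    (e : Fin (n + 1)) {j l : Fin k} (hjl : j ≠ l) (h : (Fin k → Bool) → A.carrier)
    {g : Fin k → Bool} (hg : g j = false) :
    shiftRot D e j l h (Function.update g l false) =
      shiftRot D e j l h (Function.update g l true) := by
  simp [shiftRot, hg, hjl, Function.update_comm hjl]

/-- If the two lines in direction `j` of the `(j,l)`-square of `h` at `g` are constant, then
so is the line of the shift rotation in direction `l` at `g`. -/
theorem shiftRot_line_of_const {σ : Signature} {A : Alg σ} {n k : ℕ} (D : DayOps A n)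
    (e : Fin (n + 1)) {j l : Fin k} (hjl : j ≠ l) (h : (Fin k → Bool) → A.carrier)
    {g : Fin k → Bool}
    (hg : ∀ c, h (Function.update (Function.update g l c) j false) =
      h (Function.update (Function.update g l c) j true)) :
    shiftRot D e j l h (Function.update g l false) =
      shiftRot D e j l h (Function.update g l true) := by
  cases hgj : g j
  · exact shiftRot_line_of_eq_false D e hjl h hgj
  · simp [shiftRot, hgj, hjl, Function.update_comm hjl, hg, D.idem]

theorem hIter_props {σ : Signature} (A : Alg σ) (n : ℕ) (D : DayOps A n)
    (k : ℕ) (hk : 2 ≤ k) (θ : Fin k → Congruence A)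
    (h : (Fin k → Bool) → A.carrier) (hh : IsMatrix θ h) :
    ∀ (m : ℕ) (hm1 : 1 ≤ m) (hmk : m < k) (d : Fin m → Fin (n+1)),
      IsMatrix θ (hIter D m hmk d h) ∧
      ∀ g : Fin k → Bool, (∃ j : Fin k, j.val < m ∧ g j = false) →
        hIter D m hmk d h (Function.update g ⟨m, hmk⟩ false) =
        hIter D m hmk d h (Function.update g ⟨m, hmk⟩ true) := by
  intro m _ hmk d
  clear * - hh
  induction m with
  | zero => exact ⟨hh, by rintro g ⟨j, hj, -⟩; omega⟩
  | succ m ih =>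
    obtain ⟨hM, hline⟩ := ih (by omega) (fun i => d i.castSucc)
    have hne : (⟨m, by omega⟩ : Fin k) ≠ ⟨m + 1, hmk⟩ := by simp
    refine ⟨hM.shiftRot D _ hne, ?_⟩
    rintro g ⟨j, hj, hgj⟩
    rcases Nat.lt_succ_iff_lt_or_eq.mp hj with hjm | hjm
    · refine shiftRot_line_of_const D _ hne _ (fun c => hline _ ⟨j, hjm, ?_⟩)
      rwa [Function.update_of_ne (Fin.ne_of_val_ne (by dsimp only; omega))]
    · have hj' : j = ⟨m, by omega⟩ := Fin.ext hjm
      rw [hj'] at hgj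
      exact shiftRot_line_of_eq_false D _ hne _ hgj

end UACommutator
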